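/- Let A be an m×n real matrix with nonnegative entries and b ∈ ℝ^m nonnegative, with LIN > 0 the attained optimal value of min{‖x‖₁ : Ax ≥ b, x ≥ 0}. Let δ > 0 and let α be a positive integer. Let x' be feasible with ‖x'‖₁ ≤ (1+δ)·LIN and ‖x'‖₁ ≥ 2α·(1/δ + 1). Let C ≥ δ·LIN and let y' ∈ ℕ^n be an integral feasible solution with ‖y'‖₁ ≤ LIN + 2C, ‖y'‖₁ ≥ (m+2)·(1/δ + 2), and y'_i ≥ x'_i for all i. Assume x' and y' have exactly the same set of nonzero components, of cardinality K ≤ C. Then there exist a feasible x'' and an integral feasible y'' ∈ ℕ^n such that: ‖x''‖₁ ≤ (1+δ)·LIN − α; either ‖y''‖₁ ≤ ‖y'‖₁ − α or ‖y''‖₁ ≤ ‖x''‖₁ + C; x'' and y'' have the same set of nonzero components, of cardinality at most C; x''_i ≤ y''_i for all i; and ‖y'' − y'‖₁ ≤ 2(m+2)·(1/δ + 2) + 4α·(1/δ + 2) + m + 2. -/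

import Mathlib

open Finset

theorem aux_avg {ι : Type*} [DecidableEq ι] (w : ι → ℝ) (k : ℕ) :
    ∀ (T : Finset ι) (r : ℕ), T.card = k → r ≤ k →
      ∃ S ⊆ T, S.card = r ∧ (k : ℝ) * ∑ j ∈ S, w j ≤ r * ∑ j ∈ T, w j := by
  induction k with
  | zero =>
    intro T r hT hr
    exact ⟨∅, by simp, by simp; omega, by have : r = 0 := by omega
                                          subst this; simp⟩
  | succ k ih =>
    intro T r hT hr
    rcases Nat.lt_or_ge k r with h | h
    · have : r = k + 1 := by omega
      subst this
      exact ⟨T, subset_rfl, hT, le_rfl⟩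
    · have hne : T.Nonempty := by
        rw [← Finset.card_pos]; omega
      obtain ⟨e, he, hmax⟩ := Finset.exists_max_image T w hne
      have hc : (T.erase e).card = k := by rw [Finset.card_erase_of_mem he]; omega
      obtain ⟨S, hS, hSc, hSw⟩ := ih (T.erase e) r hc h
      refine ⟨S, hS.trans (Finset.erase_subset _ _), hSc, ?_⟩
      have hsum : ∑ j ∈ T, w j = w e + ∑ j ∈ T.erase e, w j := (Finset.add_sum_erase _ _ he).symm
      have hle : ∑ j ∈ S, w j ≤ r * w e := by
        calc ∑ j ∈ S, w j ≤ ∑ j ∈ S, w e :=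
              Finset.sum_le_sum (fun j hj => hmax j (Finset.mem_of_mem_erase (hS hj)))
          _ = r * w e := by simp [hSc]
      rw [hsum]; push_cast
      nlinarith

theorem aux_ivt {n : ℕ} (p q : Fin n → ℕ) (hpq : ∀ j, p j ≤ q j) (d : ℕ) :
    ∑ j, p j + d ≤ ∑ j, q j → ∃ f : Fin n → ℕ, (∀ j, p j ≤ f j) ∧ (∀ j, f j ≤ q j) ∧
      ∑ j, f j = ∑ j, p j + d := by
  induction d with
  | zero => intro _; exact ⟨p, fun _ => le_rfl, hpq, rfl⟩
  | succ d ih =>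
    intro h
    obtain ⟨f, h1, h2, h3⟩ := ih (by omega)
    have : ∃ j ∈ (univ : Finset (Fin n)), f j < q j := by
      apply Finset.exists_lt_of_sum_lt; omega
    obtain ⟨j, -, hj⟩ := this
    refine ⟨f + Pi.single j 1, fun i => (h1 i).trans (by simp), fun i => ?_, ?_⟩
    · by_cases hi : i = j
      · subst hi; simp; omega
      · simp [hi, h2 i]
    · simp [Finset.sum_add_distrib, h3, Finset.sum_pi_single']; omega

theorem aux_basic {m n : ℕ} (A : Matrix (Fin m) (Fin n) ℝ) (k : ℕ) :
    ∀ (u : Fin n → ℝ), (∀ j, 0 ≤ u j) → (univ.filter (fun j => u j ≠ 0)).card = k →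
    ∃ z : Fin n → ℝ, (∀ j, 0 ≤ z j) ∧ A.mulVec z = A.mulVec u ∧ ∑ j, z j ≤ ∑ j, u j ∧
      (univ.filter (fun j => z j ≠ 0)).card ≤ m := by
  induction k using Nat.strong_induction_on with
  | _ k ih =>
    intro u hu hk
    rcases Nat.lt_or_ge m k with hmk | hmk
    swap
    · exact ⟨u, hu, rfl, le_rfl, by omega⟩
    -- dependence
    have hv : ∃ v : Fin n → ℝ, A.mulVec v = 0 ∧ (∀ j, u j = 0 → v j = 0) ∧ ∃ j, v j ≠ 0 := by
      set T := univ.filter (fun j => u j ≠ 0) with hT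
      have hnl : ¬ LinearIndependent ℝ (fun j : T => A.col j) := by
        intro hli
        have := hli.fintype_card_le_finrank
        simp at this
        omega
      rw [Fintype.not_linearIndependent_iff] at hnl
      obtain ⟨g, hg, j0, hj0⟩ := hnl
      refine ⟨fun j => if h : j ∈ T then g ⟨j, h⟩ else 0, ?_, ?_, j0, ?_⟩
      · rw [← hg]
        ext i
        simp only [Matrix.mulVec, dotProduct, Finset.sum_apply, Pi.smul_apply, smul_eq_mul, Matrix.col_apply]
        rw [Finset.univ_eq_attach, ← Finset.sum_subset (Finset.subset_univ T), ← Finset.sum_attach T]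
        · apply Finset.sum_congr rfl
          intro j _
          simp [mul_comm]
        · intro j _ hj; simp [hj]
      · intro j hj; simp [hT, hj]
      · simpa using hj0
    have hv' : ∃ v : Fin n → ℝ, A.mulVec v = 0 ∧ (∀ j, u j = 0 → v j = 0) ∧ (∃ j, v j < 0) ∧
        ∑ j, v j ≤ 0 := by
      obtain ⟨v, h1, h2, j, hj⟩ := hv
      have key : ∀ v : Fin n → ℝ, v j ≠ 0 → ∑ j, v j ≤ 0 → ∃ j, v j < 0 := by
        intro v hj hs
        by_contra! hcon
        have := (Finset.sum_eq_zero_iff_of_nonneg (fun i _ => hcon i)).1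
          (le_antisymm hs (Finset.sum_nonneg (fun i _ => hcon i))) j (mem_univ _)
        exact hj this
      rcases le_total (∑ j, v j) 0 with hs | hs
      · exact ⟨v, h1, h2, key v hj hs, hs⟩
      · have hs' : ∑ j, (-v) j ≤ 0 := by simpa using hs
        exact ⟨-v, by simp [Matrix.mulVec_neg, h1], fun i hi => by simp [h2 i hi],
          key (-v) (by simpa using hj) hs', hs'⟩
    obtain ⟨v, h1, h2, ⟨j1, hj1⟩, hs⟩ := hv'
    obtain ⟨e, he, hmin⟩ := Finset.exists_min_image (univ.filter (fun j => v j < 0))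
      (fun j => u j / (- v j)) ⟨j1, by simp [hj1]⟩
    have hve : v e < 0 := by simpa using he
    set l := u e / (- v e) with hl
    have hl0 : 0 ≤ l := div_nonneg (hu e) (by linarith)
    have hz0 : ∀ j, 0 ≤ (u + l • v) j := by
      intro j
      simp only [Pi.add_apply, Pi.smul_apply, smul_eq_mul]
      rcases lt_or_ge (v j) 0 with hj | hj
      · have := hmin j (by simp [hj])
        rw [le_div_iff₀ (by linarith)] at this
        linarith
      · have := hu j; positivity
    have hze : (u + l • v) e = 0 := by
      simp only [Pi.add_apply, Pi.smul_apply, smul_eq_mul, hl]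
      field_simp [hve.ne]
      ring
    have hlt : (univ.filter (fun j => (u + l • v) j ≠ 0)).card < k := by
      rw [← hk]
      apply Finset.card_lt_card
      rw [Finset.ssubset_iff_of_subset]
      · refine ⟨e, ?_, ?_⟩
        · simp only [mem_filter, mem_univ, true_and]
          intro h; exact hve.ne (h2 e h)
        · simp only [mem_filter, mem_univ, true_and, hze]; simp
      · intro j
        simp only [mem_filter, mem_univ, true_and]
        intro h h'
        exact h (by simp [h', h2 j h'])
    obtain ⟨z, z1, z2, z3, z4⟩ := ih _ hlt (u + l • v) hz0 rfl
    refine ⟨z, z1, ?_, ?_, z4⟩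
    · rw [z2, Matrix.mulVec_add, Matrix.mulVec_smul, h1]; simp
    · refine z3.trans ?_
      simp only [Pi.add_apply, Pi.smul_apply, smul_eq_mul, Finset.sum_add_distrib, ← Finset.mul_sum]
      nlinarith

set_option maxHeartbeats 4000000 in
theorem algorithm5_correct
    (m n : ℕ) (hm : 0 < m) (hn : 0 < n)
    (A : Matrix (Fin m) (Fin n) ℝ) (hA : ∀ i j, 0 ≤ A i j)
    (b : Fin m → ℝ) (hb : ∀ i, 0 ≤ b i)
    (xOPT : Fin n → ℝ)
    (hxOPTnonneg : ∀ j, 0 ≤ xOPT j)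
    (hxOPTfeas : ∀ i, b i ≤ A.mulVec xOPT i)
    (hxOPTopt : ∀ x : Fin n → ℝ, (∀ j, 0 ≤ x j) → (∀ i, b i ≤ A.mulVec x i) →
      ∑ j, |xOPT j| ≤ ∑ j, |x j|)
    (LIN : ℝ) (hLIN : LIN = ∑ j, |xOPT j|) (hLINpos : 0 < LIN)
    (δ : ℝ) (hδ : 0 < δ) (α : ℕ) (hα : 0 < α)
    (x' : Fin n → ℝ)
    (hx'nonneg : ∀ j, 0 ≤ x' j)
    (hx'feas : ∀ i, b i ≤ A.mulVec x' i)
    (hx'val : ∑ j, |x' j| ≤ (1 + δ) * LIN)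
    (hx'big : 2 * (α : ℝ) * (1 / δ + 1) ≤ ∑ j, |x' j|)
    (C : ℝ) (hC : δ * LIN ≤ C)
    (y' : Fin n → ℕ)
    (hy'feas : ∀ i, b i ≤ A.mulVec (fun j => (y' j : ℝ)) i)
    (hy'val : ∑ j, (y' j : ℝ) ≤ LIN + 2 * C)
    (hy'big : ((m : ℝ) + 2) * (1 / δ + 2) ≤ ∑ j, (y' j : ℝ))
    (hy'ge : ∀ j, x' j ≤ (y' j : ℝ))
    (hsupp : ∀ j, x' j ≠ 0 ↔ y' j ≠ 0)
    (K : ℕ) (hK : (Finset.univ.filter (fun j => y' j ≠ 0)).card = K)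
    (hKle : (K : ℝ) ≤ C) :
    ∃ x'' : Fin n → ℝ, ∃ y'' : Fin n → ℕ,
      (∀ j, 0 ≤ x'' j) ∧ (∀ i, b i ≤ A.mulVec x'' i) ∧
      (∀ i, b i ≤ A.mulVec (fun j => (y'' j : ℝ)) i) ∧
      ∑ j, |x'' j| ≤ (1 + δ) * LIN - α ∧
      (∑ j, (y'' j : ℝ) ≤ (∑ j, (y' j : ℝ)) - α ∨
        ∑ j, (y'' j : ℝ) ≤ (∑ j, |x'' j|) + C) ∧
      (∀ j, x'' j ≠ 0 ↔ y'' j ≠ 0) ∧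
      ((Finset.univ.filter (fun j => y'' j ≠ 0)).card : ℝ) ≤ C ∧
      (∀ j, x'' j ≤ (y'' j : ℝ)) ∧
      ∑ j, |(y'' j : ℝ) - (y' j : ℝ)| ≤
        2 * ((m : ℝ) + 2) * (1 / δ + 2) + 4 * (α : ℝ) * (1 / δ + 2) + m + 2 := by
  have habs : ∀ x : Fin n → ℝ, (∀ j, 0 ≤ x j) → ∑ j, |x j| = ∑ j, x j :=
    fun x hx => Finset.sum_congr rfl (fun j _ => abs_of_nonneg (hx j))
  have hLs : LIN ≤ ∑ j, x' j := by
    rw [hLIN, ← habs x' hx'nonneg]; exact hxOPTopt x' hx'nonneg hx'feas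
  rw [habs xOPT hxOPTnonneg] at hLIN
  rw [habs x' hx'nonneg] at hx'val hx'big
  set s := ∑ j, x' j with hs
  have hspos : 0 < s := lt_of_lt_of_le hLINpos hLs
  have hαR : (1 : ℝ) ≤ α := by exact_mod_cast hα
  have hmR : (1 : ℝ) ≤ m := by exact_mod_cast hm
  set D := 1 / δ with hD
  have hDpos : 0 < D := by positivity
  have hDδ : D * δ = 1 := by rw [hD]; field_simp
  have hLC : LIN ≤ C * D := by
    have : LIN = (δ * LIN) * D := by rw [mul_right_comm, mul_comm δ D, hDδ, one_mul]
    rw [this]; gcongr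
  have hCm : (m : ℝ) + 2 ≤ C := by
    have h1 : ((m : ℝ) + 2) * (D + 2) ≤ C * (D + 2) := by linarith
    exact le_of_mul_le_mul_right h1 (by linarith)
  have hC0 : 0 ≤ C := by linarith
  set c := ⌊C⌋₊ with hc
  have hcC : (c : ℝ) ≤ C := Nat.floor_le hC0
  have hCc : C < c + 1 := Nat.lt_floor_add_one C
  have hmc : m + 2 ≤ c := Nat.le_floor (by push_cast; exact hCm)
  have hKc : K ≤ c := Nat.le_floor hKle
  -- kill set
  set T := univ.filter (fun j => y' j ≠ 0) with hT
  have hKr : K + m - c ≤ K := by omega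
  obtain ⟨S, hST, hSr, hSw⟩ := aux_avg (fun j => x' j + (y' j : ℝ)) K T (K + m - c) hK hKr
  set r := K + m - c with hr
  have hTall : ∑ j ∈ T, (x' j + (y' j : ℝ)) = s + ∑ j, (y' j : ℝ) := by
    rw [hs, ← Finset.sum_add_distrib]
    apply Finset.sum_subset (Finset.subset_univ _)
    intro j _ hj
    have h0 : y' j = 0 := by simpa [hT] using hj
    have h1 : x' j = 0 := by
      by_contra h; exact (hsupp j).1 h h0
    simp [h0, h1]
  rw [hTall] at hSw
  have hYpos : 0 < ∑ j, (y' j : ℝ) := lt_of_lt_of_le (by positivity) hy'big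
  have hKpos : 0 < K := by
    rw [← hK, Finset.card_pos]
    by_contra hne
    rw [Finset.not_nonempty_iff_eq_empty] at hne
    rw [hne] at hTall
    simp at hTall
    linarith
  set kx := ∑ j ∈ S, x' j with hkx
  set ky := ∑ j ∈ S, y' j with hky
  have hkxy : ∑ j ∈ S, (x' j + (y' j : ℝ)) = kx + (ky : ℝ) := by
    rw [Finset.sum_add_distrib, hky]; push_cast; rfl
  rw [hkxy] at hSw
  have hkx0 : 0 ≤ kx := Finset.sum_nonneg (fun j _ => hx'nonneg j)
  have hkxky : kx ≤ ky := by
    rw [hky]; push_cast; exact Finset.sum_le_sum (fun j _ => hy'ge j)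
  have hcpos : (0 : ℝ) < c := by
    have : 0 < c := by omega
    exact_mod_cast this
  have hKR : (0 : ℝ) < K := by exact_mod_cast hKpos
  have hrK : (r : ℝ) * c ≤ K * m := by
    rcases Nat.le_total c (K + m) with h | h
    · have hr' : (r : ℝ) = K + m - c := by rw [hr]; push_cast [Nat.cast_sub h]; ring
      have h1 : (K : ℝ) ≤ c := by exact_mod_cast hKc
      have h2 : (m : ℝ) + 2 ≤ c := by exact_mod_cast hmc
      rw [hr']
      have h3 : 0 ≤ ((c : ℝ) - K) * (c - m) := mul_nonneg (by linarith) (by linarith)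
      linarith
    · have : r = 0 := by omega
      rw [this]; simp; positivity
  have hk : kx + ky ≤ (m + 1) * (2 * D + 3) := by
    have hW : s + ∑ j, (y' j : ℝ) ≤ C * (2 * D + 3) := by linarith
    have hW0 : 0 ≤ s + ∑ j, (y' j : ℝ) := by positivity
    have e1 : c * (K * (kx + ky)) ≤ K * m * (s + ∑ j, (y' j : ℝ)) :=
      calc c * (K * (kx + ky)) ≤ c * (r * (s + ∑ j, (y' j : ℝ))) := by gcongr
        _ = (r * c) * (s + ∑ j, (y' j : ℝ)) := by ring
        _ ≤ _ := by gcongr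
    have e2 : c * (kx + ky) ≤ m * (s + ∑ j, (y' j : ℝ)) := by
      apply le_of_mul_le_mul_left _ hKR
      linarith
    have e3 : m * C ≤ c * (m + 1) := by
      have h2 : (m : ℝ) + 2 ≤ c := by exact_mod_cast hmc
      have h3 := mul_le_mul_of_nonneg_left hCc.le (by linarith : (0 : ℝ) ≤ m)
      linarith
    have e4 : c * (kx + ky) ≤ c * ((m + 1) * (2 * D + 3)) :=
      calc c * (kx + ky) ≤ m * (s + ∑ j, (y' j : ℝ)) := e2
        _ ≤ m * (C * (2 * D + 3)) := by gcongr
        _ = (m * C) * (2 * D + 3) := by ring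
        _ ≤ (c * (m + 1)) * (2 * D + 3) := by gcongr
        _ = _ := by ring
    exact le_of_mul_le_mul_left e4 hcpos
  -- fractional step
  set t := (α : ℝ) * (D + 1) with ht
  have htpos : 0 < t := by positivity
  have hts : 2 * t ≤ s := by rw [ht]; linarith
  set τ := t / s with hτ
  have hτ0 : 0 < τ := by positivity
  have hτs : τ * s = t := by rw [hτ]; field_simp
  have hτ1 : τ < 1 := by rw [hτ, div_lt_one hspos]; linarith
  set xf : Fin n → ℝ := fun j => if j ∈ S then 0 else (1 - τ) * x' j with hxf
  have hxf0 : ∀ j, 0 ≤ xf j := by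
    intro j; simp only [hxf]; split_ifs
    · exact le_rfl
    · exact mul_nonneg (by linarith) (hx'nonneg j)
  set u : Fin n → ℝ := fun j => (if j ∈ S then (1 - τ) * x' j else 0) + τ * xOPT j with hu
  have hu0 : ∀ j, 0 ≤ u j := by
    intro j; simp only [hu]
    have h1 := mul_nonneg hτ0.le (hxOPTnonneg j)
    have h2 := mul_nonneg (sub_nonneg.2 hτ1.le) (hx'nonneg j)
    split_ifs <;> linarith
  have hxfu : xf + u = (1 - τ) • x' + τ • xOPT := by
    ext j; simp only [hxf, hu, Pi.add_apply, Pi.smul_apply, smul_eq_mul]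
    split_ifs <;> ring
  have hsumu : ∑ j, u j = (1 - τ) * kx + τ * LIN := by
    simp only [hu, Finset.sum_add_distrib, ← Finset.mul_sum, ← hLIN]
    rw [Finset.sum_ite_mem, Finset.univ_inter, ← Finset.mul_sum]
  have hsumxfu : ∑ j, xf j + ∑ j, u j = (1 - τ) * s + τ * LIN := by
    have h := congrArg (fun f : Fin n → ℝ => ∑ j, f j) hxfu
    simp only [Pi.add_apply, Pi.smul_apply, smul_eq_mul, Finset.sum_add_distrib,
      ← Finset.mul_sum, ← hLIN] at h
    exact h
  obtain ⟨z, hz0, hzA, hzu, hzm⟩ := aux_basic A _ u hu0 rfl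
  -- objective
  have hobj : (1 - τ) * s + τ * LIN ≤ (1 + δ) * LIN - α := by
    have hM : 0 < (1 + δ) * LIN := by positivity
    have h1 : t * δ = α * (1 + δ) := by
      rw [ht]; linear_combination (α : ℝ) * hDδ
    -- multiply by s (1+δ)
    have h2 : τ * ((1 + δ) * LIN - s) ≤ (1 + δ) * ((1 + δ) * LIN - s) := by
      apply mul_le_mul_of_nonneg_right _ (by linarith); linarith
    have h3 : (1 + δ) * (((1 - τ) * s + τ * LIN) - ((1 + δ) * LIN - α)) ≤ 0 := by
      have h4 : (1 + δ) * (((1 - τ) * s + τ * LIN) - ((1 + δ) * LIN - α)) =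
          τ * ((1 + δ) * LIN - s) - (1 + δ) * ((1 + δ) * LIN - s) := by
        linear_combination (-δ) * hτs - h1
      linarith
    by_contra hcon
    push Not at hcon
    have : 0 < (1 + δ) * (((1 - τ) * s + τ * LIN) - ((1 + δ) * LIN - α)) :=
      mul_pos (by linarith) (by linarith)
    linarith
  have hzsum : ∑ j, z j ≤ kx + t := by
    have h1 : τ * LIN ≤ t := by rw [← hτs]; gcongr
    have h2 : (1 - τ) * kx ≤ kx := by
      have := mul_nonneg hτ0.le hkx0
      linarith
    linarith
  -- integral part
  set w : Fin n → ℕ := fun j => ⌈z j⌉₊ with hw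
  set U := ∑ j, w j with hU
  have hceil : ∀ f : Fin n → ℝ, (∀ j, 0 ≤ f j) →
      ((∑ j, ⌈f j⌉₊ : ℕ) : ℝ) ≤ ∑ j, f j + ((univ.filter (fun j => f j ≠ 0)).card : ℝ) := by
    intro f hf
    rw [Finset.card_filter]
    push_cast
    rw [← Finset.sum_add_distrib]
    apply Finset.sum_le_sum
    intro j _
    by_cases h : f j = 0
    · simp [h]
    · simp only [h, ne_eq, not_false_eq_true, if_true]
      exact (Nat.ceil_lt_add_one (hf j)).le
  have hzmR : ((univ.filter (fun j => z j ≠ 0)).card : ℝ) ≤ m := by exact_mod_cast hzm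
  have hUle : (U : ℝ) ≤ ∑ j, z j + m := (hceil z hz0).trans (by linarith)
  set p : Fin n → ℕ := fun j => ⌈xf j⌉₊ with hp
  set q : Fin n → ℕ := fun j => if j ∈ S then 0 else y' j with hq
  have hpq : ∀ j, p j ≤ q j := by
    intro j
    simp only [hp, hq, hxf]
    split_ifs
    · simp
    · apply Nat.ceil_le.2
      have h1 := mul_nonneg hτ0.le (hx'nonneg j)
      have h2 := hy'ge j
      linarith
  have hqy : ∀ j, q j ≤ y' j := by
    intro j; simp only [hq]; split_ifs <;> simp
  have hqsum : ∑ j, q j + ky = ∑ j, y' j := by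
    have h1 : ∑ j, (if j ∈ S then y' j else 0) = ky := by
      rw [Finset.sum_ite_mem, Finset.univ_inter]
    rw [← h1, ← Finset.sum_add_distrib]
    apply Finset.sum_congr rfl
    intro j _; simp only [hq]; split_ifs <;> simp
  have hxfsupp : ∀ j, xf j ≠ 0 → j ∈ T \ S := by
    intro j hj
    simp only [hxf] at hj
    split_ifs at hj with h
    · exact absurd rfl hj
    · rw [Finset.mem_sdiff]
      refine ⟨?_, h⟩
      have : x' j ≠ 0 := right_ne_zero_of_mul hj
      simp [hT, (hsupp j).1 this]
  have hTS : (T \ S).card + m ≤ c := by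
    rw [Finset.card_sdiff_of_subset hST, hK, hSr]; omega
  have hTSR : ((T \ S).card : ℝ) + m ≤ C := by
    have : (((T \ S).card + m : ℕ) : ℝ) ≤ c := by exact_mod_cast hTS
    push_cast at this; linarith
  have hPle : ((∑ j, p j : ℕ) : ℝ) ≤ ∑ j, xf j + (T \ S).card := by
    refine (hceil xf hxf0).trans ?_
    have : (univ.filter (fun j => xf j ≠ 0)).card ≤ (T \ S).card := by
      apply Finset.card_le_card
      intro j hj
      exact hxfsupp j (by simpa using hj)
    have : ((univ.filter (fun j => xf j ≠ 0)).card : ℝ) ≤ (T \ S).card := by exact_mod_cast this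
    linarith
  have hPQ : ∑ j, p j ≤ ∑ j, q j := Finset.sum_le_sum (fun j _ => hpq j)
  obtain ⟨f, hpf, hfq, hf1, hf2⟩ : ∃ f : Fin n → ℕ, (∀ j, p j ≤ f j) ∧ (∀ j, f j ≤ q j) ∧
      (∑ j, f j + U + α ≤ ∑ j, y' j ∨ ∑ j, f j = ∑ j, p j) ∧
      (∑ j, y' j ≤ ∑ j, f j + ky ∨ ∑ j, y' j ≤ ∑ j, f j + U + α) := by
    by_cases h1 : U + α ≤ ky
    · exact ⟨q, hpq, fun _ => le_rfl, Or.inl (by omega), Or.inl (by omega)⟩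
    · by_cases h2 : ∑ j, p j + U + α ≤ ∑ j, y' j
      · obtain ⟨f, a1, a2, a3⟩ := aux_ivt p q hpq (∑ j, y' j - (∑ j, p j + U + α)) (by omega)
        exact ⟨f, a1, a2, Or.inl (by omega), Or.inr (by omega)⟩
      · exact ⟨p, fun _ => le_rfl, hpq, Or.inr rfl, Or.inr (by omega)⟩
  have hx0 : ∀ j, 0 ≤ (xf + z) j := fun j => add_nonneg (hxf0 j) (hz0 j)
  have hfxf : ∀ j, xf j ≤ f j := fun j =>
    (Nat.le_ceil (xf j)).trans (by exact_mod_cast hpf j)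
  have hzw : ∀ j, z j ≤ w j := fun j => Nat.le_ceil (z j)
  have hxy : ∀ j, (xf + z) j ≤ ((f + w) j : ℕ) := by
    intro j; simp only [Pi.add_apply]; push_cast
    exact add_le_add (hfxf j) (hzw j)
  have hxfeas : ∀ i, b i ≤ A.mulVec (xf + z) i := by
    intro i
    rw [Matrix.mulVec_add, hzA, ← Matrix.mulVec_add, hxfu, Matrix.mulVec_add,
      Matrix.mulVec_smul, Matrix.mulVec_smul]
    simp only [Pi.add_apply, Pi.smul_apply, smul_eq_mul]
    have h1 := mul_le_mul_of_nonneg_left (hx'feas i) (sub_nonneg.2 hτ1.le)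
    have h2 := mul_le_mul_of_nonneg_left (hxOPTfeas i) hτ0.le
    linarith
  have hsuppf : ∀ j, xf j = 0 ↔ f j = 0 := by
    intro j
    constructor
    · intro h
      have : q j = 0 := by
        simp only [hq]
        split_ifs with hjS
        · rfl
        · by_contra hy
          have h3 := (hsupp j).2 hy
          simp only [hxf, hjS, if_false] at h
          exact (mul_ne_zero (by linarith) h3) h
      have := hfq j
      omega
    · intro h
      have := hfxf j
      rw [h] at this
      exact le_antisymm (by simpa using this) (hxf0 j)
  have hsuppz : ∀ j, z j = 0 ↔ w j = 0 := by
    intro j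
    simp only [hw, Nat.ceil_eq_zero]
    exact ⟨fun h => h.le, fun h => le_antisymm h (hz0 j)⟩
  have hsupp2 : ∀ j, (xf + z) j = 0 ↔ (f + w) j = 0 := by
    intro j
    simp only [Pi.add_apply]
    rw [add_eq_zero_iff_of_nonneg (hxf0 j) (hz0 j), hsuppf, hsuppz]
    omega
  have hxsum : ∑ j, |(xf + z) j| = ∑ j, xf j + ∑ j, z j := by
    rw [habs _ hx0]; simp only [Pi.add_apply, Finset.sum_add_distrib]
  have hysum : ∑ j, (((f + w) j : ℕ) : ℝ) = ((∑ j, f j : ℕ) : ℝ) + U := by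
    simp only [Pi.add_apply, hU]; push_cast; rw [Finset.sum_add_distrib]
  refine ⟨xf + z, f + w, hx0, hxfeas, ?_, ?_, ?_, ?_, ?_, hxy, ?_⟩
  · intro i
    refine (hxfeas i).trans ?_
    simp only [Matrix.mulVec, dotProduct]
    exact Finset.sum_le_sum (fun j _ => mul_le_mul_of_nonneg_left (hxy j) (hA i j))
  · rw [hxsum]; linarith
  · rw [hxsum, hysum]
    rcases hf1 with h | h
    · left
      have : ((∑ j, f j + U + α : ℕ) : ℝ) ≤ ((∑ j, y' j : ℕ) : ℝ) := by exact_mod_cast h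
      push_cast at this ⊢
      linarith
    · right
      rw [h]
      linarith
  · intro j; exact not_congr (hsupp2 j)
  · have hsub : univ.filter (fun j => (f + w) j ≠ 0) ⊆
        (T \ S) ∪ univ.filter (fun j => z j ≠ 0) := by
      intro j hj
      have hj' : (f + w) j ≠ 0 := by simpa using hj
      rw [Finset.mem_union]
      by_cases h : xf j = 0
      · right
        simp only [mem_filter, mem_univ, true_and]
        intro h'
        exact hj' ((hsupp2 j).1 (by simp [h, h']))
      · exact Or.inl (hxfsupp j h)
    have := (Finset.card_le_card hsub).trans (Finset.card_union_le _ _)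
    have h2 : ((univ.filter (fun j => (f + w) j ≠ 0)).card : ℝ) ≤ ((T \ S).card + m : ℕ) := by
      exact_mod_cast this.trans (by omega)
    push_cast at h2
    linarith
  · have hd : ∑ j, |(((f + w) j : ℕ) : ℝ) - (y' j : ℝ)| ≤
        ∑ j, (((y' j : ℝ) - f j) + w j) := by
      apply Finset.sum_le_sum
      intro j _
      have h1 : (f j : ℝ) ≤ y' j := by exact_mod_cast (hfq j).trans (hqy j)
      have h2 : (0 : ℝ) ≤ w j := Nat.cast_nonneg _
      simp only [Pi.add_apply]; push_cast
      rw [abs_le]; constructor <;> linarith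
    refine hd.trans ?_
    rw [Finset.sum_add_distrib, Finset.sum_sub_distrib]
    have hUe : ∑ j, (w j : ℝ) = U := by rw [hU]; push_cast; rfl
    rw [hUe]
    have hαD : 0 ≤ (α : ℝ) * D := by positivity
    have hmD : 0 ≤ (m : ℝ) * D := by positivity
    have hf2' : ∑ j, (y' j : ℝ) ≤ ∑ j, (f j : ℝ) + ky ∨
        ∑ j, (y' j : ℝ) ≤ ∑ j, (f j : ℝ) + U + α := by
      rcases hf2 with h | h
      · left; exact_mod_cast h
      · right; exact_mod_cast h
    rcases hf2' with h | h
    · linarith [ht, hk, hzsum, hUle, h, hαD, hmD]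
    · linarith [ht, hk, hzsum, hUle, h, hαD, hmD, hkxky]
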